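/- arXiv:2109.15306 — 4 statements merged into one kernel-verified Lean document; each statement's English description precedes it below -/
import Mathlib

section
/- Let a be a complex number, let k be a nonnegative integer, and let x be a complex number with Im(a·x) > 0. Then the k-th iterated derivative of t ↦ cot(a·t) at x equals -i·δ_{0k} - 2i·(2i a)^k·Li_{-k}(e^{2i a x}), where δ_{0k} = 1 if k = 0 and 0 otherwise; explicitly, it equals -i·δ_{0k} - 2i·(2i a)^k·Σ_{n=1}^{∞} n^k e^{2i a x n}. -/
open Finset Complex

lemma polylog_summable (k : ℕ) (r : ℝ) (h0 : 0 ≤ r) (h1 : r < 1) :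
    Summable (fun n : ℕ => ((n : ℝ) + 1) ^ k * r ^ (n + 1)) := by
  have h := summable_pow_mul_geometric_of_norm_lt_one k (r := r)
    (by rwa [Real.norm_of_nonneg h0])
  have h2 := (summable_nat_add_iff 1).2 h
  simpa using h2

lemma polylog_hasDerivAt (k : ℕ) (w : ℂ) (hw : ‖w‖ < 1) :
    ∃ d : ℂ, HasDerivAt (fun z : ℂ => ∑' n : ℕ, ((n : ℂ) + 1) ^ k * z ^ (n + 1)) d w ∧
      d * w = ∑' n : ℕ, ((n : ℂ) + 1) ^ (k + 1) * w ^ (n + 1) := by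
  obtain ⟨r, hr1, hr2⟩ := exists_between hw
  have h0 : 0 ≤ r := (norm_nonneg _).trans hr1.le
  have hs := polylog_summable k r h0 hr2
  have ho : IsOpen (Metric.ball (0 : ℂ) r) := Metric.isOpen_ball
  have hwm : w ∈ Metric.ball (0 : ℂ) r := by simpa using hr1
  have hd : ∀ n : ℕ, DifferentiableOn ℂ (fun z : ℂ => ((n : ℂ) + 1) ^ k * z ^ (n + 1))
      (Metric.ball (0 : ℂ) r) := fun n => by fun_prop
  have hb : ∀ (n : ℕ) (z : ℂ), z ∈ Metric.ball (0 : ℂ) r →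
      ‖((n : ℂ) + 1) ^ k * z ^ (n + 1)‖ ≤ ((n : ℝ) + 1) ^ k * r ^ (n + 1) := by
    intro n z hz
    have hz' : ‖z‖ ≤ r := by
      have : ‖z‖ < r := by simpa using hz
      exact this.le
    have hn : ‖(n : ℂ) + 1‖ = (n : ℝ) + 1 := by
      have := Complex.norm_natCast (n + 1)
      push_cast at this
      exact this
    rw [norm_mul, norm_pow, norm_pow, hn]
    gcongr
  have hdiff := (Complex.differentiableOn_tsum_of_summable_norm hs hd ho hb).differentiableAt
    (ho.mem_nhds hwm)
  have hsum := Complex.hasSum_deriv_of_summable_norm hs hd ho hb hwm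
  refine ⟨_, hdiff.hasDerivAt, ?_⟩
  rw [← (hsum.mul_right w).tsum_eq]
  refine tsum_congr fun n => ?_
  have : HasDerivAt (fun z : ℂ => ((n : ℂ) + 1) ^ k * z ^ (n + 1))
      (((n : ℂ) + 1) ^ k * (((n + 1 : ℕ) : ℂ) * w ^ n)) w := by
    simpa using (hasDerivAt_pow (n + 1) w).const_mul (((n : ℂ) + 1) ^ k)
  rw [this.deriv]
  push_cast
  ring

lemma norm_exp_two_I_lt (z : ℂ) (h : 0 < z.im) : ‖Complex.exp (2 * I * z)‖ < 1 := by
  rw [Complex.norm_exp, Real.exp_lt_one_iff]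
  simp [mul_re, mul_im]
  exact h

lemma cot_eq_series (z : ℂ) (h : 0 < z.im) :
    Complex.cot z = -I - 2 * I * ∑' n : ℕ, Complex.exp (2 * I * z) ^ (n + 1) := by
  have hq := norm_exp_two_I_lt z h
  have e : ∑' n : ℕ, Complex.exp (2 * I * z) ^ (n + 1) =
      (1 - Complex.exp (2 * I * z))⁻¹ * Complex.exp (2 * I * z) := by
    simp_rw [pow_succ]
    rw [tsum_mul_right, tsum_geometric_of_norm_lt_one hq]
  rw [e, Complex.cot_eq_exp_ratio]
  have hne : 1 - Complex.exp (2 * I * z) ≠ 0 := by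
    intro h0
    rw [sub_eq_zero] at h0
    rw [← h0] at hq
    simp at hq
  field_simp
  ring_nf
  simp only [I_sq]
  ring

/-- For `a : ℂ`, `k : ℕ` and `x : ℂ` with `Im(a·x) > 0`,
`d^k/dx^k cot(ax) = -i·δ_{0k} - 2i·(2ia)^k·Li_{-k}(e^{2iax})`,
where `Li_{-k}(z) = ∑_{n=1}^∞ n^k z^n`. -/
theorem iteratedDeriv_cot (a : ℂ) (k : ℕ) (x : ℂ) (h : 0 < (a * x).im) :
    iteratedDeriv k (fun t => Complex.cot (a * t)) x =
      -I * (if k = 0 then 1 else 0) - 2 * I * (2 * I * a) ^ k *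
        ∑' n : ℕ, ((n : ℂ) + 1) ^ k * Complex.exp (2 * I * (a * x)) ^ (n + 1) := by
  induction k generalizing x with
  | zero => simp [cot_eq_series _ h]
  | succ k ih =>
    rw [iteratedDeriv_succ]
    have ho : IsOpen {t : ℂ | 0 < (a * t).im} :=
      isOpen_lt continuous_const (by fun_prop)
    have hev : iteratedDeriv k (fun t => Complex.cot (a * t)) =ᶠ[nhds x] fun t =>
        -I * (if k = 0 then 1 else 0) - 2 * I * (2 * I * a) ^ k *
        ∑' n : ℕ, ((n : ℂ) + 1) ^ k * Complex.exp (2 * I * (a * t)) ^ (n + 1) := by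
      filter_upwards [ho.mem_nhds h] with t ht using ih t ht
    rw [hev.deriv_eq]
    obtain ⟨d, hd, hdw⟩ := polylog_hasDerivAt k _ (norm_exp_two_I_lt _ h)
    have hE : HasDerivAt (fun t : ℂ => Complex.exp (2 * I * (a * t)))
        (Complex.exp (2 * I * (a * x)) * (2 * I * (a * 1))) x :=
      (((hasDerivAt_id x).const_mul a).const_mul (2 * I)).cexp
    have hc := (((HasDerivAt.comp x hd hE).const_mul (2 * I * (2 * I * a) ^ k)).const_sub
      (-I * (if k = 0 then 1 else 0)))
    refine hc.deriv.trans ?_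
    rw [← hdw]
    simp
    ring
end

section
/- Let a be a complex number, let k be a nonnegative integer, and let x be a complex number with Im(a·x) > 0. Then the k-th iterated derivative of t ↦ 1/sin(a·t) at x equals -2i·(2i a)^k·e^{i a x}·Φ(e^{2i a x}, -k, 1/2); explicitly, it equals -2i·(2i a)^k·e^{i a x}·Σ_{n=0}^{∞} (n + 1/2)^k e^{2i a x n}. -/
open Finset Complex

/-- The terms of the series. -/
noncomputable def cscTerm (k n : ℕ) (w : ℂ) : ℂ :=
  ((n : ℂ) + 1 / 2) ^ k * Complex.exp ((2 * n + 1) * I * w)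

lemma cscTerm_bound (k n : ℕ) (c : ℝ) (hc : 0 < c) (w : ℂ) (hw : c < w.im) :
    ‖cscTerm k n w‖ ≤ ((n + 1 : ℕ) : ℝ) ^ k * Real.exp (-c) ^ (n + 1) := by
  unfold cscTerm
  rw [norm_mul, norm_pow, Complex.norm_exp, ← Real.exp_nat_mul]
  have h1 : ‖(n : ℂ) + 1 / 2‖ ≤ ((n + 1 : ℕ) : ℝ) := by
    have : (n : ℂ) + 1 / 2 = ((n + 1 / 2 : ℝ) : ℂ) := by push_cast; ring
    rw [this, Complex.norm_real, Real.norm_of_nonneg (by positivity)]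
    push_cast; linarith
  have h2 : ((2 * n + 1) * I * w : ℂ).re ≤ ((n + 1 : ℕ) : ℝ) * (-c) := by
    have : ((2 * n + 1) * I * w : ℂ).re = - (2 * n + 1) * w.im := by
      simp; ring
    rw [this]
    have hn : (0 : ℝ) ≤ n := Nat.cast_nonneg n
    push_cast
    nlinarith [mul_nonneg hn hc.le, mul_nonneg hn (sub_nonneg.2 hw.le)]
  gcongr

lemma cscBound_summable (k : ℕ) (c : ℝ) (hc : 0 < c) :
    Summable fun n : ℕ => ((n + 1 : ℕ) : ℝ) ^ k * Real.exp (-c) ^ (n + 1) := by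
  have := summable_pow_mul_geometric_of_norm_lt_one (R := ℝ) k (r := Real.exp (-c)) (by
    rw [Real.norm_of_nonneg (Real.exp_pos _).le]
    exact Real.exp_lt_one_iff.2 (by linarith))
  exact (summable_nat_add_iff (f := fun n : ℕ => (n : ℝ) ^ k * Real.exp (-c) ^ n) 1).2 this

lemma cscTerm_hasDerivAt (k n : ℕ) (w : ℂ) :
    HasDerivAt (cscTerm k n) (2 * I * cscTerm (k + 1) n w) w := by
  have h := ((((hasDerivAt_id w).const_mul ((2 * n + 1) * I : ℂ)).cexp).const_mul
    (((n : ℂ) + 1 / 2) ^ k))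
  refine h.congr_deriv ?_
  simp only [cscTerm, id]
  ring

lemma cscSum_hasDerivAt (k : ℕ) (w : ℂ) (hw : 0 < w.im) :
    HasDerivAt (fun z => ∑' n, cscTerm k n z) (2 * I * ∑' n, cscTerm (k + 1) n w) w := by
  have hc : 0 < w.im / 2 := by linarith
  have hm : w ∈ {z : ℂ | w.im / 2 < z.im} := by simp only [Set.mem_ofPred_eq]; linarith
  rw [← tsum_mul_left]
  refine hasDerivAt_tsum_of_isPreconnected
    (u := fun n : ℕ => 2 * (((n + 1 : ℕ) : ℝ) ^ (k + 1) * Real.exp (-(w.im / 2)) ^ (n + 1)))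
    (t := {z : ℂ | w.im / 2 < z.im}) (g' := fun n y => 2 * I * cscTerm (k + 1) n y)
    ((cscBound_summable (k + 1) _ hc).mul_left 2)
    (isOpen_lt continuous_const Complex.continuous_im)
    (convex_halfSpace_im_gt _).isPreconnected
    (fun n y _ => cscTerm_hasDerivAt k n y) ?_ hm ?_ hm
  · intro n y hy
    have := cscTerm_bound (k + 1) n _ hc y hy
    simpa using this
  · exact Summable.of_norm_bounded (cscBound_summable k _ hc)
      (fun n => cscTerm_bound k n _ hc w hm)

lemma cscSum_eq (k : ℕ) (w : ℂ) : ∑' n, cscTerm k n w = Complex.exp (I * w) *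
    ∑' n : ℕ, ((n : ℂ) + 1 / 2) ^ k * Complex.exp (2 * I * w) ^ n := by
  rw [← tsum_mul_left]
  congr 1
  ext n
  rw [cscTerm, ← Complex.exp_nat_mul, mul_left_comm, ← Complex.exp_add]
  congr 2
  ring

lemma csc_base (w : ℂ) (hw : 0 < w.im) :
    1 / Complex.sin w = -2 * I * ∑' n, cscTerm 0 n w := by
  have hq : ‖Complex.exp (2 * I * w)‖ < 1 := by
    rw [Complex.norm_exp]
    apply Real.exp_lt_one_iff.2
    simp
    linarith
  rw [cscSum_eq]
  simp only [pow_zero, one_mul]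
  rw [tsum_geometric_of_norm_lt_one hq]
  have hne : 1 - Complex.exp (2 * I * w) ≠ 0 := by
    intro h0
    rw [← sub_eq_zero.1 h0] at hq
    simp at hq
  have he := Complex.exp_ne_zero (I * w)
  have h2 : Complex.exp (2 * I * w) = Complex.exp (I * w) ^ 2 := by
    rw [← Complex.exp_nat_mul]; congr 1; push_cast; ring
  have hs : Complex.sin w = (1 - Complex.exp (2 * I * w)) * I / (2 * Complex.exp (I * w)) := by
    rw [Complex.sin, h2, show -w * I = -(I * w) by ring, Complex.exp_neg, mul_comm w I]
    field_simp
  rw [hs]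
  field_simp
  simp

/-- For `a : ℂ`, `k : ℕ` and `x : ℂ` with `Im(a·x) > 0`,
`d^k/dx^k (1/sin(ax)) = -2i·(2ia)^k·e^{iax}·Φ(e^{2iax},-k,1/2)`,
where `Φ(z,-k,1/2) = ∑_{n=0}^∞ (n+1/2)^k z^n`. -/
theorem iteratedDeriv_csc (a : ℂ) (k : ℕ) (x : ℂ) (h : 0 < (a * x).im) :
    iteratedDeriv k (fun t => 1 / Complex.sin (a * t)) x =
      -2 * I * (2 * I * a) ^ k * Complex.exp (I * (a * x)) *
        ∑' n : ℕ, ((n : ℂ) + 1 / 2) ^ k * Complex.exp (2 * I * (a * x)) ^ n := by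
  rw [mul_assoc _ (Complex.exp _), ← cscSum_eq]
  induction k generalizing x with
  | zero => simpa using csc_base (a * x) h
  | succ k ih =>
    rw [iteratedDeriv_succ]
    have hev : iteratedDeriv k (fun t => 1 / Complex.sin (a * t)) =ᶠ[nhds x]
        fun y => -2 * I * (2 * I * a) ^ k * ∑' n, cscTerm k n (a * y) := by
      have ho : IsOpen {y : ℂ | 0 < (a * y).im} :=
        isOpen_lt continuous_const (by fun_prop)
      filter_upwards [ho.mem_nhds h] with y hy using ih y hy
    rw [hev.deriv_eq]
    have hd := ((cscSum_hasDerivAt k (a * x) h).comp x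
      ((hasDerivAt_id x).const_mul a)).const_mul (-2 * I * (2 * I * a) ^ k)
    refine (hd.congr_deriv ?_).deriv
    ring
end

section
/- Let a, b be complex numbers, let k be a nonnegative integer, and let x be a complex number with Im(a·x + b) > 0. Then the k-th iterated derivative of t ↦ 1/cos(a·t + b) at x equals 2·(2i a)^k·e^{i(a x + b)}·Φ(-e^{2i(a x + b)}, -k, 1/2); explicitly, it equals 2·(2i a)^k·e^{i(a x + b)}·Σ_{n=0}^{∞} (-1)^n (n + 1/2)^k e^{2i(a x + b)n}. -/
open Finset Complex

noncomputable def secTerm (a b : ℂ) (k n : ℕ) (t : ℂ) : ℂ :=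
  2 * (2 * I * a) ^ k * ((-1 : ℂ) ^ n * ((n : ℂ) + 1 / 2) ^ k) *
    Complex.exp ((2 * n + 1) * I * (a * t + b))

lemma secTerm_hasDerivAt (a b : ℂ) (k n : ℕ) (t : ℂ) :
    HasDerivAt (secTerm a b k n) (secTerm a b (k + 1) n t) t := by
  have h1 : HasDerivAt (fun t : ℂ => (2 * n + 1) * I * (a * t + b))
      ((2 * n + 1) * I * (a * 1)) t :=
    (((hasDerivAt_id t).const_mul a).add_const b).const_mul _
  have h2 := (h1.cexp).const_mul
    (2 * (2 * I * a) ^ k * ((-1 : ℂ) ^ n * ((n : ℂ) + 1 / 2) ^ k))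
  unfold secTerm
  refine h2.congr_deriv ?_
  rw [pow_succ, pow_succ]
  ring

lemma sec_summable_bound (k : ℕ) (c : ℝ) (hc : 0 < c) :
    Summable (fun n : ℕ => ((n : ℝ) + 1) ^ k * Real.exp (-c) ^ n) := by
  have hr : ‖Real.exp (-c)‖ < 1 := by
    rw [Real.norm_eq_abs, abs_of_pos (Real.exp_pos _)]
    exact Real.exp_lt_one_iff.2 (by linarith)
  have h0 : Summable (fun n : ℕ => (n : ℝ) ^ k * Real.exp (-c) ^ n) :=
    summable_pow_mul_geometric_of_norm_lt_one k hr
  have h := (summable_nat_add_iff (f := fun n : ℕ => (n : ℝ) ^ k * Real.exp (-c) ^ n) 1).2 h0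
  have h2 := h.mul_right (Real.exp (-c))⁻¹
  refine h2.congr fun n => ?_
  have := (Real.exp_pos (-c)).ne'
  push_cast
  rw [pow_succ]
  field_simp

lemma secTerm_bound (a b : ℂ) (k n : ℕ) (t : ℂ) (c : ℝ) (hc : 0 < c)
    (h : c < (a * t + b).im) :
    ‖secTerm a b k n t‖ ≤
      ‖2 * (2 * I * a) ^ k‖ * (((n : ℝ) + 1) ^ k * Real.exp (-c) ^ n) := by
  unfold secTerm
  rw [norm_mul, norm_mul (2 * (2 * I * a) ^ k), mul_assoc]
  refine mul_le_mul_of_nonneg_left ?_ (norm_nonneg _)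
  refine mul_le_mul ?_ ?_ (norm_nonneg _) (by positivity)
  · rw [norm_mul, norm_pow, norm_pow, norm_neg, norm_one, one_pow, one_mul]
    refine pow_le_pow_left₀ (norm_nonneg _) ?_ _
    refine (norm_add_le _ _).trans ?_
    rw [Complex.norm_natCast]
    norm_num
  · rw [Complex.norm_exp, ← Real.exp_nat_mul]
    apply Real.exp_le_exp.2
    have : ((2 * (n : ℂ) + 1) * I * (a * t + b)).re = -((2 * n + 1) * (a * t + b).im) := by
      have e : (2 * (n : ℂ) + 1) * I * (a * t + b)
        = ((2 * n + 1 : ℝ) : ℂ) * (I * (a * t + b)) := by push_cast; ring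
      rw [e, Complex.re_ofReal_mul, Complex.I_mul_re]; ring
    rw [this]
    have hn : (0 : ℝ) ≤ n := n.cast_nonneg
    nlinarith [mul_nonneg hn (sub_nonneg.2 h.le), mul_nonneg hn hc.le]

lemma secTerm_eq (a b : ℂ) (k n : ℕ) (t : ℂ) : secTerm a b k n t =
    2 * (2 * I * a) ^ k * Complex.exp (I * (a * t + b)) *
      ((-1 : ℂ) ^ n * ((n : ℂ) + 1 / 2) ^ k * Complex.exp (2 * I * (a * t + b)) ^ n) := by
  unfold secTerm
  have : Complex.exp ((2 * n + 1) * I * (a * t + b)) =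
      Complex.exp (I * (a * t + b)) * Complex.exp (2 * I * (a * t + b)) ^ n := by
    rw [← Complex.exp_nat_mul, ← Complex.exp_add]
    congr 1; ring
  rw [this]; ring

lemma sec_zero (a b t : ℂ) (h : 0 < (a * t + b).im) :
    1 / Complex.cos (a * t + b) = ∑' n, secTerm a b 0 n t := by
  simp_rw [secTerm_eq]
  rw [tsum_mul_left]
  set w := a * t + b
  have hq : ‖-Complex.exp (2 * I * w)‖ < 1 := by
    rw [norm_neg, Complex.norm_exp]
    apply Real.exp_lt_one_iff.2
    have : (2 * I * w).re = -(2 * w.im) := by simp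
    rw [this]; linarith
  have e : ∀ n : ℕ, (-1 : ℂ) ^ n * ((n : ℂ) + 1 / 2) ^ 0 * Complex.exp (2 * I * w) ^ n
      = (-Complex.exp (2 * I * w)) ^ n := fun n => by
    rw [neg_pow (Complex.exp _)]; simp
  simp_rw [e]
  rw [tsum_geometric_of_norm_lt_one hq, Complex.cos]
  have h1 : (1 : ℂ) - -Complex.exp (2 * I * w) ≠ 0 := by
    intro h0
    rw [← sub_eq_zero.1 h0] at hq
    simp at hq
  have e1 : Complex.exp (2 * I * w) = Complex.exp (I * w) ^ 2 := by
    rw [← Complex.exp_nat_mul]; congr 1; push_cast; ring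
  have e2 : Complex.exp (-w * I) = (Complex.exp (I * w))⁻¹ := by
    rw [← Complex.exp_neg]; congr 1; ring
  rw [e1] at h1 ⊢
  rw [e2, mul_comm w I]
  have h3 := Complex.exp_ne_zero (I * w)
  generalize Complex.exp (I * w) = z at *
  have h4 : z + z⁻¹ ≠ 0 := by
    intro h0
    apply h1
    field_simp at h0
    linear_combination h0
  have h5 : 1 + z ^ 2 ≠ 0 := by simpa using h1
  rw [sub_neg_eq_add]
  have h6 : z + z⁻¹ = (1 + z ^ 2) / z := by field_simp; ring
  rw [h6]
  field_simp

lemma sec_iter (a b : ℂ) (k : ℕ) : ∀ x : ℂ, 0 < (a * x + b).im →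
    iteratedDeriv k (fun t => 1 / Complex.cos (a * t + b)) x = ∑' n, secTerm a b k n x := by
  have hcont : Continuous fun t : ℂ => (a * t + b).im :=
    Complex.continuous_im.comp (by fun_prop)
  induction k with
  | zero => intro x h; rw [iteratedDeriv_zero]; exact sec_zero a b x h
  | succ k ih =>
    intro x h
    rw [iteratedDeriv_succ]
    have hev : iteratedDeriv k (fun t => 1 / Complex.cos (a * t + b)) =ᶠ[nhds x]
        fun t => ∑' n, secTerm a b k n t := by
      filter_upwards [(isOpen_lt continuous_const hcont).mem_nhds h] with t ht
      exact ih t ht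
    rw [hev.deriv_eq]
    have hc : 0 < (a * x + b).im / 2 := by linarith
    have := Complex.hasSum_deriv_of_summable_norm
      (U := {t : ℂ | (a * x + b).im / 2 < (a * t + b).im})
      ((sec_summable_bound k _ hc).mul_left ‖2 * (2 * I * a) ^ k‖)
      (F := fun n => secTerm a b k n)
      (fun n t _ => (secTerm_hasDerivAt a b k n t).differentiableAt.differentiableWithinAt)
      (isOpen_lt continuous_const hcont)
      (fun n t ht => secTerm_bound a b k n t _ hc ht)
      (show (a * x + b).im / 2 < (a * x + b).im by linarith)
    rw [← this.tsum_eq]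
    exact tsum_congr fun n => (secTerm_hasDerivAt a b k n x).deriv

/-- For `a b : ℂ`, `k : ℕ` and `x : ℂ` with `Im(a·x+b) > 0`,
`d^k/dx^k (1/cos(ax+b)) = 2·(2ia)^k·e^{i(ax+b)}·Φ(-e^{2i(ax+b)},-k,1/2)`,
where `Φ(-z,-k,1/2) = ∑_{n=0}^∞ (-1)^n (n+1/2)^k z^n`. -/
theorem iteratedDeriv_sec_translated (a b : ℂ) (k : ℕ) (x : ℂ) (h : 0 < (a * x + b).im) :
    iteratedDeriv k (fun t => 1 / Complex.cos (a * t + b)) x =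
      2 * (2 * I * a) ^ k * Complex.exp (I * (a * x + b)) *
        ∑' n : ℕ, (-1 : ℂ) ^ n * ((n : ℂ) + 1 / 2) ^ k *
          Complex.exp (2 * I * (a * x + b)) ^ n := by
  rw [sec_iter a b k x h, ← tsum_mul_left]
  exact tsum_congr fun n => secTerm_eq a b k n x
end

section
/- Let a be a complex number, let b be a complex number with Re(b) < 0 (so that |e^{b}| < 1 and e^{b} ≠ 1), and let k be a positive integer. Then the k-th iterated derivative of x ↦ x/(e^{a x + b} - 1) at x = 0 equals -k·(δ_{1k} + Li_{-k+1}(e^{b}))·a^{k-1}, where δ_{1k} = 1 if k = 1 and 0 otherwise; explicitly, it equals -k·(δ_{1k} + Σ_{n=1}^{∞} n^{k-1} e^{b n})·a^{k-1}. -/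
open Finset Complex

/-- The series `∑ n^j e^{(ax+b)n}`. -/
noncomputable def polyL (a b : ℂ) (j : ℕ) (x : ℂ) : ℂ :=
  ∑' n : ℕ, (n : ℂ) ^ j * Complex.exp (a * x + b) ^ n

lemma polyL_isOpen (a b : ℂ) (c : ℝ) : IsOpen {x : ℂ | (a * x + b).re < c} :=
  isOpen_lt (by fun_prop) continuous_const

lemma polyL_hasDerivAt (a b : ℂ) (j : ℕ) (x : ℂ) (hx : (a * x + b).re < 0) :
    HasDerivAt (polyL a b j) (a * polyL a b (j + 1) x) x := by
  obtain ⟨c, hxc, hc⟩ := exists_between hx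
  set U : Set ℂ := {x : ℂ | (a * x + b).re < c} with hU
  have hUo : IsOpen U := polyL_isOpen a b c
  have hr : ‖Real.exp c‖ < 1 := by
    rw [Real.norm_eq_abs, Real.abs_exp]; exact Real.exp_lt_one_iff.mpr hc
  have hsum : Summable fun n : ℕ => (n : ℝ) ^ j * Real.exp c ^ n :=
    summable_pow_mul_geometric_of_norm_lt_one j hr
  have hF : ∀ n : ℕ, ∀ y : ℂ,
      HasDerivAt (fun y => (n : ℂ) ^ j * Complex.exp (a * y + b) ^ n)
        (a * ((n : ℂ) ^ (j + 1) * Complex.exp (a * y + b) ^ n)) y := by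
    intro n y
    have h1 : HasDerivAt (fun y => (n : ℂ) ^ j * Complex.exp (n * (a * y + b)))
        ((n : ℂ) ^ j * (Complex.exp (n * (a * y + b)) * (n * (a * 1)))) y :=
      (((((hasDerivAt_id y).const_mul a).add_const b).const_mul (n : ℂ)).cexp).const_mul _
    simp only [Complex.exp_nat_mul] at h1
    convert h1 using 1
    ring
  have hle : ∀ (n : ℕ) (y : ℂ), y ∈ U →
      ‖(n : ℂ) ^ j * Complex.exp (a * y + b) ^ n‖ ≤ (n : ℝ) ^ j * Real.exp c ^ n := by
    intro n y hy
    rw [norm_mul, norm_pow, norm_pow, Complex.norm_natCast, Complex.norm_exp]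
    have : Real.exp (a * y + b).re ≤ Real.exp c := Real.exp_le_exp.mpr (le_of_lt hy)
    gcongr
  have hd := differentiableOn_tsum_of_summable_norm hsum
    (fun n y _ => (hF n y).differentiableAt.differentiableWithinAt) hUo hle
  have hs := hasSum_deriv_of_summable_norm hsum
    (fun n y _ => (hF n y).differentiableAt.differentiableWithinAt) hUo hle
    (show x ∈ U from hxc)
  have h2 := (hd.differentiableAt (hUo.mem_nhds hxc)).hasDerivAt
  rw [← hs.tsum_eq] at h2
  simp only [(hF _ x).deriv] at h2
  rw [tsum_mul_left] at h2
  exact h2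

lemma polyL_zero (a b x : ℂ) (hx : (a * x + b).re < 0) :
    x / (Complex.exp (a * x + b) - 1) = -(x * polyL a b 0 x) := by
  have hn : ‖Complex.exp (a * x + b)‖ < 1 := by
    rw [Complex.norm_exp]; exact Real.exp_lt_one_iff.mpr hx
  unfold polyL
  simp only [pow_zero, one_mul]
  rw [tsum_geometric_of_norm_lt_one hn, div_eq_mul_inv, ← mul_neg, ← inv_neg, neg_sub]

lemma iteratedDeriv_polyL (a b : ℂ) (k : ℕ) : ∀ x : ℂ, (a * x + b).re < 0 →
    iteratedDeriv k (fun x => x / (Complex.exp (a * x + b) - 1)) x =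
      -(x * (a ^ k * polyL a b k x) + k * a ^ (k - 1) * polyL a b (k - 1) x) := by
  induction k with
  | zero => intro x hx; simp [polyL_zero a b x hx]
  | succ k ih =>
    intro x hx
    have hev : iteratedDeriv k (fun x => x / (Complex.exp (a * x + b) - 1)) =ᶠ[nhds x]
        fun x => -(x * (a ^ k * polyL a b k x) + k * a ^ (k - 1) * polyL a b (k - 1) x) :=
      Filter.eventually_of_mem ((polyL_isOpen a b 0).mem_nhds hx) ih
    rw [iteratedDeriv_succ, hev.deriv_eq]
    have h := (((hasDerivAt_id x).mul ((polyL_hasDerivAt a b k x hx).const_mul (a ^ k))).add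
      ((polyL_hasDerivAt a b (k - 1) x hx).const_mul (k * a ^ (k - 1)))).neg
    refine (HasDerivAt.deriv h).trans ?_
    cases k with
    | zero => simp; ring
    | succ m =>
      simp only [id, Nat.add_sub_cancel]
      push_cast
      ring

/-- For `a : ℂ`, `b : ℂ` with `Re b < 0`, and `k ≥ 1`,
`d^k/dx^k (x/(e^{ax+b}-1)) |_{x=0} = -k·(δ_{1k} + Li_{-k+1}(e^b))·a^{k-1}`,
where `Li_{-k+1}(z) = ∑_{n=1}^∞ n^{k-1} z^n`. -/
theorem iteratedDeriv_exp_quotient (a b : ℂ) (hb : b.re < 0) (k : ℕ) (hk : 1 ≤ k) :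
    iteratedDeriv k (fun x => x / (Complex.exp (a * x + b) - 1)) 0 =
      -(k : ℂ) * ((if k = 1 then 1 else 0) +
          ∑' n : ℕ, ((n : ℂ) + 1) ^ (k - 1) * Complex.exp b ^ (n + 1)) * a ^ (k - 1) := by
  rw [iteratedDeriv_polyL a b k 0 (by simpa using hb)]
  have hn : ‖Complex.exp b‖ < 1 := by
    rw [Complex.norm_exp]; exact Real.exp_lt_one_iff.mpr hb
  have hs : Summable fun n : ℕ => (n : ℂ) ^ (k - 1) * Complex.exp b ^ n :=
    summable_pow_mul_geometric_of_norm_lt_one (k - 1) hn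
  have h0 : polyL a b (k - 1) 0 = (if k = 1 then 1 else 0) +
      ∑' n : ℕ, ((n : ℂ) + 1) ^ (k - 1) * Complex.exp b ^ (n + 1) := by
    unfold polyL
    simp only [mul_zero, zero_add]
    rw [hs.tsum_eq_zero_add]
    push_cast
    congr 1
    obtain ⟨m, rfl⟩ : ∃ m, k = m + 1 := ⟨k - 1, by omega⟩
    cases m <;> simp
  rw [h0]
  ring
end
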